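/- Let μ be a diagram automorphism of order 2 extended ℤ-linearly to Φ, let χ: Φ → {0,1}, and suppose σ is a conjugate-linear involution of g with σ(e_α) = (−1)^{χ(α)} e_{−μ(α)} for all α ∈ Φ. Let α₁, α₂, α₃ ∈ Δ be distinct simple roots forming a subsystem of type A₃, i.e. α₁+α₂, α₂+α₃, α₁+α₂+α₃ ∈ Φ and α₁+α₃ ∉ Φ, and assume μ(α₁) = α₃, μ(α₂) = α₂, χ(α₂) = 1 and χ(α₁) = 0. Then χ(α₁+α₂+α₃) = 1. -/

import Mathlib

open TensorProduct

set_option linter.unusedVariables false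

/-- The root space of `α` relative to the subalgebra `H`:
all `x ∈ L` with `⁅y, x⁆ = α y • x` for every `y ∈ H`. -/
def rootSpace' {L : Type*} [LieRing L] [LieAlgebra ℂ L]
    (H : LieSubalgebra ℂ L) (α : Module.Dual ℂ H) : Submodule ℂ L where
  carrier := {x | ∀ y : H, ⁅(y : L), x⁆ = α y • x}
  add_mem' := by
    intro a b ha hb y
    rw [lie_add, ha y, hb y, smul_add]
  zero_mem' := by
    intro y
    rw [lie_zero, smul_zero]
  smul_mem' := by
    intro c x hx y
    rw [lie_smul, hx y, smul_comm]

section RootSpaces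

open LieAlgebra LieAlgebra.IsKilling LieModule Module

variable {L : Type*} [LieRing L] [LieAlgebra ℂ L] {H : LieSubalgebra ℂ L}

theorem lie_mem_rootSpace' {α β : Dual ℂ H} {x y : L}
    (hx : x ∈ rootSpace' H α) (hy : y ∈ rootSpace' H β) : ⁅x, y⁆ ∈ rootSpace' H (α + β) := by
  intro h
  rw [leibniz_lie, hx h, hy h, smul_lie, lie_smul, ← add_smul, LinearMap.add_apply]

theorem lie_eq_zero_of_add_notMem {Φ : Set (Dual ℂ H)}
    (hΦ : ∀ α : Dual ℂ H, α ∈ Φ ↔ α ≠ 0 ∧ rootSpace' H α ≠ ⊥) {α β : Dual ℂ H} {x y : L}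
    (hx : x ∈ rootSpace' H α) (hy : y ∈ rootSpace' H β) (h0 : α + β ≠ 0) (h : α + β ∉ Φ) :
    ⁅x, y⁆ = 0 := by
  have hbot : rootSpace' H (α + β) = ⊥ := by
    by_contra hne
    exact h ((hΦ _).2 ⟨h0, hne⟩)
  simpa [hbot] using lie_mem_rootSpace' hx hy

/-- A difference of distinct members of a base is not a root. -/
theorem sub_notMem_of_base {V : Type*} [AddCommGroup V] [Module ℂ V] {Φ : Set V} {Δ : Finset V}
    (hind : LinearIndependent ℂ (fun b : {x // x ∈ Δ} => (b : V)))
    (hbase : ∀ γ ∈ Φ, ∃ k : V → ℤ,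
      ((∀ b ∈ Δ, 0 ≤ k b) ∨ (∀ b ∈ Δ, k b ≤ 0)) ∧ γ = ∑ b ∈ Δ, k b • b)
    {a b : V} (ha : a ∈ Δ) (hb : b ∈ Δ) (hab : a ≠ b) : a - b ∉ Φ := by
  classical
  intro h
  obtain ⟨k, hk, hsum⟩ := hbase _ h
  have hli : LinearIndepOn ℂ id (Δ : Set V) := hind
  rw [linearIndepOn_finset_iff] at hli
  have key := hli (fun c => (k c : ℂ) - (if c = a then 1 else 0) + (if c = b then 1 else 0)) (by
    simp only [id, add_smul, sub_smul, Finset.sum_add_distrib, Finset.sum_sub_distrib, ite_smul,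
      one_smul, zero_smul, Finset.sum_ite_eq', ha, hb, if_true, Int.cast_smul_eq_zsmul]
    rw [← hsum]
    abel)
  have hka : k a = 1 := by
    have := key a ha
    simp only [if_true, if_neg hab, add_zero, sub_eq_zero] at this
    exact_mod_cast this
  have hkb : k b = -1 := by
    have := key b hb
    simp only [if_true, if_neg hab.symm, sub_zero] at this
    exact_mod_cast eq_neg_of_add_eq_zero_left this
  rcases hk with hk | hk
  · have := hk b hb
    omega
  · have := hk a ha
    omega

variable [FiniteDimensional ℂ L] [IsKilling ℂ L] [H.IsCartanSubalgebra]

theorem mem_rootSpace'_iff {α : Dual ℂ H} {x : L} :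
    x ∈ rootSpace' H α ↔ x ∈ rootSpace H (α : H → ℂ) := by
  refine ⟨fun hx => weightSpace_le_genWeightSpace L _ ?_, fun hx y => ?_⟩
  · rw [mem_weightSpace]
    exact hx
  · exact lie_eq_smul_of_mem_rootSpace hx y

theorem rootSpace'_ne_bot_iff {α : Dual ℂ H} :
    rootSpace' H α ≠ ⊥ ↔ rootSpace H (α : H → ℂ) ≠ ⊥ := by
  rw [Ne, Ne, Submodule.eq_bot_iff, LieSubmodule.eq_bot_iff]
  simp only [mem_rootSpace'_iff]

/-- The weight attached to a root. -/
theorem exists_weight {α : Dual ℂ H} (h0 : α ≠ 0) (h : rootSpace' H α ≠ ⊥) :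
    ∃ W : Weight ℂ H L, W.IsNonZero ∧ (W : H → ℂ) = α ∧ Weight.toLinear ℂ H L W = α := by
  refine ⟨⟨α, rootSpace'_ne_bot_iff.1 h⟩, fun hz => h0 ?_, rfl, ?_⟩
  · ext x
    exact congrFun hz x
  · ext x
    rfl

theorem cartanEquivDual_symm_eq {hvec : Dual ℂ H → H}
    (hhvec : ∀ (lam : Dual ℂ H) (x : H), killingForm ℂ L (hvec lam : L) (x : L) = lam x)
    (α : Dual ℂ H) : (cartanEquivDual H).symm α = hvec α := by
  rw [LinearEquiv.symm_apply_eq]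
  ext x
  rw [cartanEquivDual_apply_apply]
  exact (hhvec α x).symm

theorem apply_hvec_self_ne_zero {hvec : Dual ℂ H → H}
    (hhvec : ∀ (lam : Dual ℂ H) (x : H), killingForm ℂ L (hvec lam : L) (x : L) = lam x)
    {α : Dual ℂ H} (h0 : α ≠ 0) (h : rootSpace' H α ≠ ⊥) :
    α (hvec α) ≠ 0 := by
  obtain ⟨W, hW, hWα, hWl⟩ := exists_weight h0 h
  have := root_apply_cartanEquivDual_symm_ne_zero hW
  rwa [hWl, cartanEquivDual_symm_eq hhvec, hWα] at this

theorem conj_apply_hvec_self {hvec : Dual ℂ H → H}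
    (hhvec : ∀ (lam : Dual ℂ H) (x : H), killingForm ℂ L (hvec lam : L) (x : L) = lam x)
    {α : Dual ℂ H} (h0 : α ≠ 0) (h : rootSpace' H α ≠ ⊥) :
    starRingEnd ℂ (α (hvec α)) = α (hvec α) := by
  obtain ⟨W, hW, hWα, hWl⟩ := exists_weight h0 h
  have hK := traceForm_coroot W (coroot W)
  rw [hWl, cartanEquivDual_symm_eq hhvec, root_apply_coroot hW, hWα] at hK
  have hsum := LinearMap.congr_fun (LinearMap.congr_fun
    (restrict_killingForm_eq_sum (K := ℂ) (L := L) (H := H)) (coroot W)) (coroot W)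
  have hint : ∃ n : ℤ, traceForm ℂ H L (coroot W) (coroot W) = n := by
    refine ⟨∑ β ∈ H.root, ((chainBotCoeff W β : ℤ) - chainTopCoeff W β) ^ 2, ?_⟩
    refine Eq.trans hsum ?_
    simp only [LinearMap.sum_apply, LinearMap.smulRight_apply, LinearMap.smul_apply, smul_eq_mul,
      Int.cast_sum]
    refine Finset.sum_congr rfl fun β _ => ?_
    have hβ := apply_coroot_eq_cast W β
    rw [← Weight.toLinear_apply] at hβ
    rw [Int.cast_pow, sq]
    exact congrArg₂ (· * ·) hβ hβ
  obtain ⟨n, hn⟩ := hint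
  rw [hn] at hK
  have hinv : (α (hvec α))⁻¹ = (n : ℂ) / 4 := by
    rw [hK]
    simp only [nsmul_eq_mul, smul_eq_mul]
    push_cast
    ring
  rw [← inv_inv (α (hvec α)), hinv]
  simp [Complex.conj_ofNat]

/-- If `α - β` is not a root but `α + β` is, then `α` and `β` are not orthogonal. -/
theorem apply_hvec_ne_zero {hvec : Dual ℂ H → H}
    (hhvec : ∀ (lam : Dual ℂ H) (x : H), killingForm ℂ L (hvec lam : L) (x : L) = lam x)
    {α β : Dual ℂ H} (hα0 : α ≠ 0) (hα : rootSpace' H α ≠ ⊥)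
    (hβ0 : β ≠ 0) (hβ : rootSpace' H β ≠ ⊥) (hadd : rootSpace' H (α + β) ≠ ⊥)
    (hsub : rootSpace' H (α - β) = ⊥) : α (hvec β) ≠ 0 := by
  obtain ⟨A, -, hA, -⟩ := exists_weight hα0 hα
  obtain ⟨W, hW, hWβ, hWl⟩ := exists_weight hβ0 hβ
  have hadd' : (1 : ℤ) • (W : H → ℂ) + A = ⇑(α + β) := by
    rw [one_smul, hA, hWβ, add_comm]
    rfl
  have hsub' : (-1 : ℤ) • (W : H → ℂ) + A = ⇑(α - β) := by
    rw [neg_smul, one_smul, hA, hWβ, neg_add_eq_sub]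
    rfl
  have htop := ((rootSpace_zsmul_add_ne_bot_iff W A hW 1).1
    (hadd' ▸ rootSpace'_ne_bot_iff.1 hadd)).1
  have hbot : ¬ (1 : ℤ) ≤ chainBotCoeff W A := by
    intro hle
    refine rootSpace'_ne_bot_iff.2 ?_ hsub
    have := (rootSpace_zsmul_add_ne_bot_iff W A hW (-1)).2 ⟨by omega, by simpa using hle⟩
    rwa [hsub'] at this
  intro hz
  have hc := apply_coroot_eq_cast W A
  rw [coroot, hWl, cartanEquivDual_symm_eq hhvec, hA] at hc
  simp only [map_nsmul, map_smul, hz, smul_zero] at hc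
  have : (chainBotCoeff W A : ℤ) - chainTopCoeff W A = 0 := by exact_mod_cast hc.symm
  omega

end RootSpaces

theorem statement17
    {L : Type*} [LieRing L] [LieAlgebra ℂ L] [FiniteDimensional ℂ L]
    [LieAlgebra.IsSimple ℂ L]
    -- `H` is a Cartan subalgebra of the simple complex Lie algebra `L`
    (H : LieSubalgebra ℂ L) [LieSubalgebra.IsCartanSubalgebra H]
    -- `Φ` is the set of roots of `L` relative to `H`
    (Φ : Set (Module.Dual ℂ H))
    (hΦ : ∀ α : Module.Dual ℂ H, α ∈ Φ ↔ α ≠ 0 ∧ rootSpace' H α ≠ ⊥)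
    (hΦneg : ∀ γ ∈ Φ, -γ ∈ Φ)
    -- `hvec lam` is the element `h_lam ∈ H` representing `lam` via the Killing form
    (hvec : Module.Dual ℂ H → H)
    (hhvec : ∀ (lam : Module.Dual ℂ H) (x : H),
      killingForm ℂ L (hvec lam : L) (x : L) = lam x)
    -- root vectors `e α ∈ g_α \ {0}` normalized by `B (e α) (e (-α)) = 1`
    (e : Module.Dual ℂ H → L)
    (he : ∀ α ∈ Φ, e α ∈ rootSpace' H α)
    (he0 : ∀ α ∈ Φ, e α ≠ 0)
    (heB : ∀ α ∈ Φ, killingForm ℂ L (e α) (e (-α)) = 1)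
    (hee : ∀ α ∈ Φ, ⁅e α, e (-α)⁆ = (hvec α : L))
    -- structure constants `N α β`
    (N : Module.Dual ℂ H → Module.Dual ℂ H → ℂ)
    (hN : ∀ α ∈ Φ, ∀ β ∈ Φ, α + β ∈ Φ → ⁅e α, e β⁆ = N α β • e (α + β))
    (hN0 : ∀ α β : Module.Dual ℂ H, α + β ≠ 0 → α + β ∉ Φ → N α β = 0)
    -- `Δ` is a system of simple roots for `Φ`
    (Δ : Finset (Module.Dual ℂ H)) (hΔΦ : ↑Δ ⊆ Φ)
    (hind : LinearIndependent ℂ (fun b : {x // x ∈ Δ} => (b : Module.Dual ℂ H)))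
    (hbase : ∀ γ ∈ Φ, ∃ k : Module.Dual ℂ H → ℤ,
      ((∀ b ∈ Δ, 0 ≤ k b) ∨ (∀ b ∈ Δ, k b ≤ 0)) ∧ γ = ∑ b ∈ Δ, k b • b)
    -- `μhat` is the ℤ-linear extension of a diagram automorphism `μ : Δ → Δ` of order 1 or 2
    (μhat : Module.Dual ℂ H → Module.Dual ℂ H)
    (hμadd : ∀ x y, μhat (x + y) = μhat x + μhat y)
    (hμneg : ∀ x, μhat (-x) = -(μhat x))
    (hμμ : ∀ x, μhat (μhat x) = x)
    (hμΔ : ∀ b ∈ Δ, μhat b ∈ Δ)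
    (hμΦ : ∀ γ ∈ Φ, μhat γ ∈ Φ)
    (hμB : ∀ a ∈ Δ, ∀ b ∈ Δ,
      killingForm ℂ L (hvec (μhat a) : L) (hvec (μhat b) : L)
        = killingForm ℂ L (hvec a : L) (hvec b : L))
    -- `μ` has order exactly 2
    (hμne : ∃ b ∈ Δ, μhat b ≠ b)
    -- `χ : Φ → {0,1}`
    (χ : Module.Dual ℂ H → ℕ)
    (hχ01 : ∀ γ : Module.Dual ℂ H, χ γ = 0 ∨ χ γ = 1)
    -- `σ` is a conjugate-linear Lie algebra involution of `L`
    (σ : L → L)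
    (hσadd : ∀ x y, σ (x + y) = σ x + σ y)
    (hσsmul : ∀ (z : ℂ) (x : L), σ (z • x) = (starRingEnd ℂ) z • σ x)
    (hσσ : ∀ x, σ (σ x) = x)
    (hσlie : ∀ x y : L, σ ⁅x, y⁆ = ⁅σ x, σ y⁆)
    (hσe : ∀ α ∈ Φ, σ (e α) = ((-1 : ℂ) ^ (χ α)) • e (-(μhat α)))
    -- `α₁, α₂, α₃` form a subsystem of type `A₃`
    (α₁ α₂ α₃ : Module.Dual ℂ H)
    (h1 : α₁ ∈ Δ) (h2 : α₂ ∈ Δ) (h3 : α₃ ∈ Δ)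
    (h12 : α₁ ≠ α₂) (h13 : α₁ ≠ α₃) (h23 : α₂ ≠ α₃)
    (hsum12 : α₁ + α₂ ∈ Φ) (hsum23 : α₂ + α₃ ∈ Φ)
    (hsum123 : α₁ + α₂ + α₃ ∈ Φ) (hnot13 : α₁ + α₃ ∉ Φ)
    (hμ1 : μhat α₁ = α₃) (hμ2 : μhat α₂ = α₂)
    (hχ2 : χ α₂ = 1) (hχ1 : χ α₁ = 0) :
    χ (α₁ + α₂ + α₃) = 1 := by
  have hsq : ∀ γ, ((-1 : ℂ) ^ χ γ) * (-1 : ℂ) ^ χ γ = 1 := fun γ => by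
    rw [← mul_pow]; simp
  have hBsymm : ∀ x y : L, killingForm ℂ L x y = killingForm ℂ L y x :=
    LieModule.traceForm_comm ℂ L L
  have hBinv : ∀ x y z : L, killingForm ℂ L ⁅x, y⁆ z = killingForm ℂ L x ⁅y, z⁆ :=
    LieModule.traceForm_apply_lie_apply ℂ L L
  have hsymm : ∀ a b : Module.Dual ℂ H, a (hvec b) = b (hvec a) := fun a b => by
    rw [← hhvec, ← hhvec, hBsymm]
  have hμinv : ∀ a ∈ Δ, ∀ b ∈ Δ, μhat a (hvec (μhat b)) = a (hvec b) := fun a ha b hb => by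
    rw [← hhvec, ← hhvec, hμB a ha b hb]
  have hσe' : ∀ α ∈ Φ, σ (e (-α)) = (-1 : ℂ) ^ χ (-α) • e (μhat α) := fun α hα => by
    rw [hσe _ (hΦneg _ hα), hμneg, neg_neg]
  have hσh : ∀ α ∈ Φ, σ (hvec α : L) =
      -(((-1 : ℂ) ^ χ α * (-1 : ℂ) ^ χ (-α)) • (hvec (μhat α) : L)) := fun α hα => by
    rw [← hee α hα, hσlie, hσe α hα, hσe' α hα, smul_lie, lie_smul, smul_smul, ← lie_skew,
      hee _ (hμΦ α hα), smul_neg]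
  have hconj : ∀ α ∈ Φ, ∀ β ∈ Φ, starRingEnd ℂ (β (hvec α)) =
      ((-1 : ℂ) ^ χ α * (-1 : ℂ) ^ χ (-α)) * μhat β (hvec (μhat α)) := fun α hα β hβ => by
    have hl := congrArg σ (he β hβ (hvec α))
    have hμβ := hΦneg _ (hμΦ β hβ)
    rw [hσlie, hσsmul, hσh α hα, hσe β hβ, lie_smul, neg_lie, smul_lie,
      he _ hμβ (hvec (μhat α)), LinearMap.neg_apply, neg_smul, smul_neg, smul_neg, smul_neg, neg_neg,
      smul_smul, smul_smul, smul_smul] at hl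
    have hs := smul_left_injective ℂ (he0 _ hμβ) hl
    linear_combination (-(-1 : ℂ) ^ χ β) * hs + ((((-1 : ℂ) ^ χ α * (-1 : ℂ) ^ χ (-α)) *
      μhat β (hvec (μhat α))) - starRingEnd ℂ (β (hvec α))) * hsq β
  have hsign : ∀ a ∈ Δ, (-1 : ℂ) ^ χ a * (-1 : ℂ) ^ χ (-a) = 1 := fun a ha => by
    have haΦ := (hΦ a).1 (hΔΦ ha)
    have h := hconj a (hΔΦ ha) a (hΔΦ ha)
    rw [conj_apply_hvec_self hhvec haΦ.1 haΦ.2, hμinv a ha a ha] at h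
    exact (mul_eq_right₀ (apply_hvec_self_ne_zero hhvec haΦ.1 haΦ.2)).1 h.symm
  have hreal : ∀ a ∈ Δ, ∀ b ∈ Δ, starRingEnd ℂ (b (hvec a)) = b (hvec a) := fun a ha b hb => by
    rw [hconj a (hΔΦ ha) b (hΔΦ hb), hsign a ha, one_mul, hμinv b hb a ha]
  have hμ3 : μhat α₃ = α₁ := by rw [← hμ1, hμμ]
  have hχ3 : (-1 : ℂ) ^ χ α₃ = 1 := by
    have h := hσσ (e α₁)
    rw [hσe _ (hΔΦ h1), hχ1, pow_zero, one_smul, hμ1, hσe' _ (hΔΦ h3), hμ3] at h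
    have hs : (-1 : ℂ) ^ χ (-α₃) = 1 :=
      smul_left_injective ℂ (he0 _ (hΔΦ h1)) (h.trans (one_smul ℂ _).symm)
    simpa [hs] using hsign α₃ h3
  have hm : ∀ a ∈ Δ, e (-a) ∈ rootSpace' H (-a) := fun a ha => he _ (hΦneg _ (hΔΦ ha))
  have hcomm : ∀ a ∈ Δ, ∀ b ∈ Δ, a ≠ b → ⁅e a, e (-b)⁆ = 0 := fun a ha b hb hab =>
    lie_eq_zero_of_add_notMem hΦ (he a (hΔΦ ha)) (hm b hb)
      (by rw [← sub_eq_add_neg]; exact sub_ne_zero.2 hab)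
      (by rw [← sub_eq_add_neg]; exact sub_notMem_of_base hind hbase ha hb hab)
  have hne13 : α₁ + α₃ ≠ 0 := fun h0 => by
    have hlin : LinearIndepOn ℂ id (Δ : Set (Module.Dual ℂ H)) := hind
    have := (LinearIndepOn.pair_iff id h13).1
      (hlin.mono (Set.insert_subset h1 (Set.singleton_subset_iff.2 h3))) 1 1 (by simpa using h0)
    exact one_ne_zero this.1
  have hc13 : ⁅e α₁, e α₃⁆ = 0 :=
    lie_eq_zero_of_add_notMem hΦ (he _ (hΔΦ h1)) (he _ (hΔΦ h3)) hne13 hnot13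
  have hc13' : ⁅e (-α₁), e (-α₃)⁆ = 0 := by
    refine lie_eq_zero_of_add_notMem hΦ (hm _ h1) (hm _ h3) ?_ fun h => hnot13 ?_
    · rw [← neg_add]
      exact neg_ne_zero.2 hne13
    · have := hΦneg _ h
      rwa [← neg_add, neg_neg] at this
  have horth : α₁ (hvec α₃) = 0 := by
    have h : ⁅(hvec α₃ : L), e α₁⁆ = 0 := by
      rw [← hee _ (hΔΦ h3), lie_lie, ← lie_skew (e (-α₃)), ← lie_skew (e α₃) (e α₁),
        hc13, hcomm _ h1 _ h3 h13]
      simp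
    rw [he _ (hΔΦ h1)] at h
    exact (smul_eq_zero.1 h).resolve_right (he0 _ (hΔΦ h1))
  have hr0 : α₁ (hvec α₂) ≠ 0 := by
    refine apply_hvec_ne_zero hhvec ((hΦ _).1 (hΔΦ h1)).1 ((hΦ _).1 (hΔΦ h1)).2
      ((hΦ _).1 (hΔΦ h2)).1 ((hΦ _).1 (hΔΦ h2)).2 ((hΦ _).1 hsum12).2 ?_
    by_contra hne
    exact sub_notMem_of_base hind hbase h1 h2 h12 ((hΦ _).2 ⟨sub_ne_zero.2 h12, hne⟩)
  have h23r : α₂ (hvec α₃) = α₁ (hvec α₂) := by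
    have := hμinv α₂ h2 α₁ h1
    rw [hμ1, hμ2] at this
    rw [this, hsymm]
  -- the negative triple bracket, in the two possible bracketings
  have hY : ⁅⁅e (-α₃), e (-α₂)⁆, e (-α₁)⁆ = ⁅⁅e (-α₁), e (-α₂)⁆, e (-α₃)⁆ := by
    rw [lie_lie (e (-α₁)), hc13', lie_zero, sub_zero, ← lie_skew, ← lie_skew (e (-α₃)), lie_neg,
      neg_neg]
  have hU : ⁅e (-α₁), e (-α₂)⁆ ∈ rootSpace' H (-α₁ + -α₂) := lie_mem_rootSpace' (hm _ h1) (hm _ h2)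
  have h3Y : ⁅e α₃, ⁅⁅e (-α₁), e (-α₂)⁆, e (-α₃)⁆⁆ = α₁ (hvec α₂) • ⁅e (-α₁), e (-α₂)⁆ := by
    rw [leibniz_lie, leibniz_lie (e α₃), hcomm _ h3 _ h1 h13.symm, hcomm _ h3 _ h2 h23.symm,
      hee _ (hΔΦ h3), ← lie_skew _ (hvec α₃ : L), hU (hvec α₃)]
    simp [horth, h23r]
  have h2U : ⁅e α₂, ⁅e (-α₁), e (-α₂)⁆⁆ = α₁ (hvec α₂) • e (-α₁) := by
    rw [leibniz_lie, hcomm _ h2 _ h1 h12.symm, hee _ (hΔΦ h2), ← lie_skew _ (hvec α₂ : L),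
      hm _ h1 (hvec α₂)]
    simp
  have hBXY : killingForm ℂ L ⁅⁅e α₁, e α₂⁆, e α₃⁆ ⁅⁅e (-α₃), e (-α₂)⁆, e (-α₁)⁆ =
      α₁ (hvec α₂) * α₁ (hvec α₂) := by
    rw [hY, hBinv, h3Y, map_smul, hBinv, h2U, map_smul, heB _ (hΔΦ h1)]
    simp
  refine (hχ01 _).resolve_left fun hχ => ?_
  obtain ⟨c, hc⟩ : ∃ c : ℂ, ⁅⁅e α₁, e α₂⁆, e α₃⁆ = c • e (α₁ + α₂ + α₃) :=
    ⟨_, by rw [hN _ (hΔΦ h1) _ (hΔΦ h2) hsum12, smul_lie, hN _ hsum12 _ (hΔΦ h3) hsum123,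
      smul_smul]⟩
  have hμ123 : μhat (α₁ + α₂ + α₃) = α₁ + α₂ + α₃ := by
    rw [hμadd, hμadd, hμ1, hμ2, hμ3]
    abel
  have hσX := congrArg σ hc
  rw [hσlie, hσlie, hσe _ (hΔΦ h1), hσe _ (hΔΦ h2), hσe _ (hΔΦ h3), hχ1, hχ2, hχ3, hμ1, hμ2, hμ3,
    hσsmul, hσe _ hsum123, hχ, hμ123] at hσX
  simp only [pow_zero, pow_one, one_smul, neg_smul, lie_neg, neg_lie] at hσX
  rw [hc, neg_eq_iff_eq_neg.1 hσX] at hBXY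
  simp only [map_neg, map_smul, LinearMap.smul_apply, heB _ hsum123, smul_eq_mul, mul_one] at hBXY
  obtain ⟨r, hr⟩ := Complex.conj_eq_iff_real.1 (hreal α₂ h2 α₁ h1)
  rw [hr] at hBXY hr0
  have hre := congrArg Complex.re hBXY
  simp only [Complex.neg_re, Complex.mul_re, Complex.conj_re, Complex.conj_im,
    Complex.ofReal_re, Complex.ofReal_im] at hre
  have hrpos : 0 < r * r := mul_self_pos.2 fun h => hr0 (by simp [h])
  nlinarith [mul_self_nonneg c.re, mul_self_nonneg c.im]
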